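/- arXiv:1602.07035 — 4 statements merged into one kernel-verified Lean document; each statement's English description precedes it below -/
import Mathlib

section
/- Let R be an integral domain and ⋆ a star operation on R. If R has the finite ⋆-basic ideal property (every nonzero finitely generated ideal of R is ⋆-basic), then R is integrally closed in its quotient field. -/
open scoped nonZeroDivisors

open FractionalIdeal

/-- A star operation on an integral domain `R` with quotient field `K`, viewed as a map on
fractional ideals.  The defining axioms are only imposed on nonzero fractional ideals, since a
star operation is classically defined on the set of nonzero fractional ideals. -/
structure StarOperation (R K : Type*) [CommRing R] [IsDomain R] [Field K]
    [Algebra R K] [IsFractionRing R K] where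
  star : FractionalIdeal R⁰ K → FractionalIdeal R⁰ K
  star_one : star 1 = 1
  star_smul : ∀ (a : K), a ≠ 0 → ∀ I : FractionalIdeal R⁰ K, I ≠ 0 →
    star (spanSingleton R⁰ a * I) = spanSingleton R⁰ a * star I
  le_star : ∀ I : FractionalIdeal R⁰ K, I ≠ 0 → I ≤ star I
  star_mono : ∀ I J : FractionalIdeal R⁰ K, I ≠ 0 → J ≠ 0 → I ≤ J → star I ≤ star J

theorem aux_pow_le {R : Type*} [CommRing R] (a b : R) (k : ℕ) :
    (Ideal.span {a, b}) ^ (k + 1) ≤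
      Ideal.span {a ^ (k + 1)} ⊔ Ideal.span {b} * (Ideal.span {a, b}) ^ k := by
  have hI : Ideal.span {a, b} = Ideal.span {a} ⊔ Ideal.span {b} := by
    rw [← Ideal.span_union]; rfl
  induction k with
  | zero => simp [hI]
  | succ k ih =>
    have ha : Ideal.span {a} ≤ Ideal.span {a, b} := hI ▸ le_sup_left
    calc (Ideal.span {a, b}) ^ (k + 1 + 1)
        = Ideal.span {a} * Ideal.span {a, b} ^ (k + 1)
          ⊔ Ideal.span {b} * Ideal.span {a, b} ^ (k + 1) := by
          rw [pow_succ' _ (k + 1), ← Ideal.sup_mul, ← hI]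
      _ ≤ _ := by
          refine sup_le ((Ideal.mul_mono_right ih).trans ?_) le_sup_right
          rw [Ideal.mul_sup, Ideal.span_singleton_mul_span_singleton, ← pow_succ']
          refine sup_le_sup le_rfl ?_
          rw [mul_left_comm, pow_succ']
          exact Ideal.mul_mono_right (Ideal.mul_mono_left ha)

/-- If `R` has the finite `⋆`-basic ideal property (every nonzero finitely generated ideal of
`R` is `⋆`-basic), then `R` is integrally closed in its quotient field. -/
theorem isIntegrallyClosed_of_finite_star_basic
    {R K : Type*} [CommRing R] [IsDomain R] [Field K] [Algebra R K] [IsFractionRing R K]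
    (s : StarOperation R K)
    (hbasic : ∀ I : Ideal R, I ≠ ⊥ → I.FG →
      ∀ J : Ideal R, J ≠ ⊥ → J ≤ I →
        (∃ n : ℕ, s.star ((J : FractionalIdeal R⁰ K) * (I : FractionalIdeal R⁰ K) ^ n)
            = s.star ((I : FractionalIdeal R⁰ K) ^ (n + 1))) →
        s.star (J : FractionalIdeal R⁰ K) = s.star (I : FractionalIdeal R⁰ K)) :
    IsIntegrallyClosed R := by
  rw [isIntegrallyClosed_iff K]
  rintro x ⟨p, hp, hx⟩
  obtain ⟨a, b, hb, rfl⟩ := IsFractionRing.div_surjective (A := R) x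
  have hb0 : b ≠ 0 := nonZeroDivisors.ne_zero hb
  have hbK : algebraMap R K b ≠ 0 := by
    simpa using hb0
  have hroot : (p.scaleRoots b).eval a = 0 := by
    have h := Polynomial.scaleRoots_aeval_eq_zero (a := algebraMap R K a / algebraMap R K b)
      (r := b) (p := p) hx
    rw [mul_div_cancel₀ _ hbK, Polynomial.aeval_algebraMap_apply] at h
    simpa using h
  obtain ⟨n, hn⟩ : ∃ n, p.natDegree = n + 1 := by
    apply Nat.exists_eq_succ_of_ne_zero
    intro h0
    rw [hp.natDegree_eq_zero.mp h0] at hx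
    simp at hx
  set I : Ideal R := Ideal.span {a, b} with hI
  have haI : a ∈ I := Ideal.subset_span (by simp)
  have hbI : b ∈ I := Ideal.subset_span (by simp)
  have hJI : Ideal.span {b} ≤ I := (Ideal.span_singleton_le_iff_mem _).2 hbI
  have hmem : a ^ (n + 1) ∈ Ideal.span {b} * I ^ n := by
    rw [Polynomial.eval_eq_sum_range, Polynomial.natDegree_scaleRoots, hn,
      Finset.sum_range_succ] at hroot
    simp only [Polynomial.coeff_scaleRoots, hn] at hroot
    rw [← hn, hp.coeff_natDegree, hn] at hroot
    simp only [Nat.sub_self, pow_zero, one_mul, mul_one] at hroot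
    rw [eq_neg_of_add_eq_zero_right hroot]
    refine neg_mem (sum_mem fun i hi => ?_)
    have hi' : i ≤ n := Nat.lt_succ_iff.mp (Finset.mem_range.mp hi)
    have h1 : b ^ (n - i) * a ^ i ∈ I ^ n := by
      have := Ideal.mul_mem_mul (Ideal.pow_mem_pow hbI (n - i)) (Ideal.pow_mem_pow haI i)
      rwa [← pow_add, Nat.sub_add_cancel hi'] at this
    have h2 : p.coeff i * b ^ (n + 1 - i) * a ^ i
        = p.coeff i * (b * (b ^ (n - i) * a ^ i)) := by
      rw [Nat.succ_sub hi', pow_succ]; ring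
    rw [h2]
    exact Ideal.mul_mem_left _ _
      (Ideal.mul_mem_mul (Ideal.mem_span_singleton_self b) h1)
  have hred : Ideal.span {b} * I ^ n = I ^ (n + 1) := by
    apply le_antisymm
    · rw [pow_succ']; exact Ideal.mul_mono_left hJI
    · exact (aux_pow_le a b n).trans
        (sup_le ((Ideal.span_singleton_le_iff_mem _).2 hmem) le_rfl)
  have hJ0 : Ideal.span {b} ≠ ⊥ := by simpa using hb0
  have hI0 : I ≠ ⊥ := fun h => hJ0 (le_bot_iff.mp (h ▸ hJI))
  have key := hbasic I hI0 (Submodule.fg_span (Set.toFinite _)) (Ideal.span {b}) hJ0 hJI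
    ⟨n, by rw [← coeIdeal_pow, ← coeIdeal_pow, ← coeIdeal_mul, hred]⟩
  have hstar : s.star ((Ideal.span {b} : Ideal R) : FractionalIdeal R⁰ K)
      = spanSingleton R⁰ (algebraMap R K b) := by
    have := s.star_smul _ hbK 1 one_ne_zero
    rw [s.star_one, mul_one] at this; rw [coeIdeal_span_singleton, this]
  have haS : algebraMap R K a ∈ spanSingleton R⁰ (algebraMap R K b) := by
    rw [← hstar, key]
    exact s.le_star _ (coeIdeal_ne_zero.mpr hI0) (mem_coeIdeal_of_mem _ haI)
  obtain ⟨z, hz⟩ := (mem_spanSingleton _).1 haS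
  refine ⟨z, ?_⟩
  rw [eq_div_iff hbK, ← hz, Algebra.smul_def]
end

section
/- Let R be an integral domain and ⋆ a star operation on R. If R has the ⋆-basic ideal property (every nonzero ideal of R is ⋆-basic), then R is completely integrally closed, i.e., (I·I⁻¹)_v = R for every nonzero ideal I of R. -/
open scoped nonZeroDivisors

open FractionalIdeal

/-- If `R` has the `⋆`-basic ideal property (every nonzero ideal of `R` is `⋆`-basic), then
`R` is completely integrally closed: `(I·I⁻¹)_v = R` for every nonzero ideal `I` of `R`. -/
theorem completely_integrally_closed_of_star_basic
    {R K : Type*} [CommRing R] [IsDomain R] [Field K] [Algebra R K] [IsFractionRing R K]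
    (s : StarOperation R K)
    (hbasic : ∀ I : Ideal R, I ≠ ⊥ →
      ∀ J : Ideal R, J ≠ ⊥ → J ≤ I →
        (∃ n : ℕ, s.star ((J : FractionalIdeal R⁰ K) * (I : FractionalIdeal R⁰ K) ^ n)
            = s.star ((I : FractionalIdeal R⁰ K) ^ (n + 1))) →
        s.star (J : FractionalIdeal R⁰ K) = s.star (I : FractionalIdeal R⁰ K)) :
    ∀ I : Ideal R, I ≠ ⊥ →
      (((I : FractionalIdeal R⁰ K) * (I : FractionalIdeal R⁰ K)⁻¹)⁻¹)⁻¹ = 1 := by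
  intro I hI
  set F : FractionalIdeal R⁰ K := (I : FractionalIdeal R⁰ K) with hF
  have hF0 : F ≠ 0 := coeIdeal_ne_zero.mpr hI
  have hFle : F ≤ 1 := coeIdeal_le_one
  have hinv : F⁻¹ = 1 / F := rfl
  have h1inv : 1 ≤ F⁻¹ := by
    rw [hinv, le_div_iff_mul_le hF0, one_mul]; exact hFle
  have hinv0 : F⁻¹ ≠ 0 := by
    intro h
    rw [h] at h1inv
    exact one_ne_zero (le_antisymm h1inv (zero_le _))
  have hinvmul : F⁻¹ * F ≤ 1 := (le_div_iff_mul_le hF0).mp le_rfl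
  set T : FractionalIdeal R⁰ K := F⁻¹ / F⁻¹ with hT
  have hTm : T * F⁻¹ ≤ F⁻¹ := (le_div_iff_mul_le hinv0).mp le_rfl
  have h1T : 1 ≤ T := by
    rw [hT, le_div_iff_mul_le hinv0, one_mul]
  have hTT : T * T = T := by
    apply le_antisymm
    · rw [hT, le_div_iff_mul_le hinv0, ← hT, mul_assoc]
      exact (mul_le_mul_right hTm T).trans hTm
    · calc T = 1 * T := (one_mul T).symm
        _ ≤ T * T := mul_le_mul_left h1T T
  have hT1 : T ≤ 1 := by
    obtain ⟨a, A, ha, hA⟩ := exists_eq_spanSingleton_mul T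
    have ha' : algebraMap R K a ≠ 0 := by
      simpa using ha
    have hS : spanSingleton R⁰ (algebraMap R K a) * spanSingleton R⁰ (algebraMap R K a)⁻¹ = 1 := by
      rw [spanSingleton_mul_spanSingleton, mul_inv_cancel₀ ha', spanSingleton_one]
    have hA' : (A : FractionalIdeal R⁰ K) = spanSingleton R⁰ (algebraMap R K a) * T := by
      rw [hA, ← mul_assoc, hS, one_mul]
    have hJ : ((Ideal.span {a} : Ideal R) : FractionalIdeal R⁰ K)
        = spanSingleton R⁰ (algebraMap R K a) := coeIdeal_span_singleton a
    have hJA : Ideal.span {a} ≤ A := by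
      rw [← coeIdeal_le_coeIdeal K, hJ, hA']
      calc spanSingleton R⁰ (algebraMap R K a) = spanSingleton R⁰ (algebraMap R K a) * 1 :=
            (mul_one _).symm
        _ ≤ _ := mul_le_mul_right h1T _
    have hJ0 : Ideal.span {a} ≠ ⊥ := by
      simpa [Ideal.span_singleton_eq_bot] using ha
    have hA0 : A ≠ ⊥ := fun h => hJ0 (le_bot_iff.mp (h ▸ hJA))
    have key := hbasic A hA0 _ hJ0 hJA ⟨1, by
      congr 1
      rw [hJ, hA', pow_one, pow_two]
      calc _ = spanSingleton R⁰ (algebraMap R K a) * spanSingleton R⁰ (algebraMap R K a) * T := by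
            ring
        _ = spanSingleton R⁰ (algebraMap R K a) * spanSingleton R⁰ (algebraMap R K a)
              * (T * T) := by rw [hTT]
        _ = _ := by ring⟩
    have h2 := s.star_smul (algebraMap R K a) ha' 1 one_ne_zero
    rw [s.star_one, mul_one] at h2
    rw [hJ, h2] at key
    have h3 := s.le_star (A : FractionalIdeal R⁰ K) (coeIdeal_ne_zero.mpr hA0)
    rw [← key] at h3
    calc T = spanSingleton R⁰ (algebraMap R K a)⁻¹ * A := hA
      _ ≤ spanSingleton R⁰ (algebraMap R K a)⁻¹ * spanSingleton R⁰ (algebraMap R K a) :=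
          mul_le_mul_right h3 _
      _ = 1 := by rw [mul_comm, hS]
  have hP0 : F * F⁻¹ ≠ 0 := by
    intro h
    have h4 : F * 1 ≤ F * F⁻¹ := mul_le_mul_right h1inv F
    rw [h, mul_one] at h4
    exact hF0 (le_antisymm h4 (zero_le _))
  have hX : (F * F⁻¹)⁻¹ = 1 := by
    apply le_antisymm
    · refine le_trans ?_ hT1
      rw [hT, le_div_iff_mul_le hinv0]
      conv_rhs => rw [hinv]
      rw [le_div_iff_mul_le hF0, mul_assoc, mul_comm F⁻¹ F]
      exact (le_div_iff_mul_le hP0).mp le_rfl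
    · change 1 ≤ 1 / (F * F⁻¹)
      rw [le_div_iff_mul_le hP0, one_mul, mul_comm]
      exact hinvmul
  rw [hX]
  exact inv_one
end

section
/- An integral domain R (not a field) is a Prüfer v-multiplication domain if and only if R has the finite w-basic ideal property, i.e., every nonzero finitely generated ideal of R is w-basic. -/
open scoped nonZeroDivisors

section

variable {R : Type*} (K : Type*) [CommRing R] [IsDomain R] [Field K]
  [Algebra R K] [IsFractionRing R K]

/-- The `t`-operation on (nonzero) fractional ideals of `R`:
`I_t = ⋃ J_v`, where `J` ranges over the nonzero finitely generated subideals of `I` and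
`J_v = (J⁻¹)⁻¹` (realized as a supremum of `R`-submodules of `K`). -/
noncomputable def tOp (I : FractionalIdeal R⁰ K) : Submodule R K :=
  ⨆ (J : FractionalIdeal R⁰ K) (_ : J ≠ 0) (_ : J ≤ I) (_ : (J : Submodule R K).FG),
    (((J⁻¹)⁻¹ : FractionalIdeal R⁰ K) : Submodule R K)

/-- An integral ideal `M` of `R` is a `t`-ideal if `M_t = M`. -/
def IsTIdeal (M : Ideal R) : Prop :=
  tOp K (M : FractionalIdeal R⁰ K) = ((M : FractionalIdeal R⁰ K) : Submodule R K)

/-- `M` is a maximal `t`-ideal of `R`: maximal among the proper integral `t`-ideals. -/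
def IsMaxTIdeal (M : Ideal R) : Prop :=
  M ≠ ⊤ ∧ IsTIdeal K M ∧ ∀ N : Ideal R, N ≠ ⊤ → IsTIdeal K N → M ≤ N → M = N

/-- The extension `A·R_M` of an `R`-submodule `A` of `K` to the localization `R_M ⊆ K`
(for `M` a prime ideal of `R`): the set of fractions `a/t` with `a ∈ A`, `t ∉ M`. -/
noncomputable def locMul (M : Ideal R) (A : Submodule R K) : Submodule R K :=
  ⨆ (t : R) (_ : t ∉ M), Submodule.span R {(algebraMap R K t)⁻¹} * A

/-- The `w`-operation: `I_w = ⋂ I·R_M`, the intersection taken over all maximal `t`-ideals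
`M` of `R`. -/
noncomputable def wOp (I : FractionalIdeal R⁰ K) : Submodule R K :=
  ⨅ (M : Ideal R) (_ : IsMaxTIdeal K M), locMul K M (I : Submodule R K)

/-- `R` is a Prüfer `v`-multiplication domain: every nonzero finitely generated ideal is
`t`-invertible. -/
def IsPvMD : Prop :=
  ∀ I : Ideal R, I ≠ ⊥ → I.FG →
    tOp K ((I : FractionalIdeal R⁰ K) * (I : FractionalIdeal R⁰ K)⁻¹) = 1

end


section helpers

set_option linter.unusedSectionVars false

variable {R K : Type*} [CommRing R] [IsDomain R] [Field K]
  [Algebra R K] [IsFractionRing R K]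

lemma aux_fg_le (P : Set (Submodule R K)) (hne : P.Nonempty)
    (hdir : ∀ A ∈ P, ∀ B ∈ P, ∃ C ∈ P, A ≤ C ∧ B ≤ C) (J : Submodule R K) (hJ : J.FG)
    (h : ∀ x ∈ J, ∃ A ∈ P, x ∈ A) : ∃ A ∈ P, J ≤ A := by
  classical
  obtain ⟨S, rfl⟩ := hJ
  have key : ∀ T : Finset K, (∀ x ∈ T, ∃ A ∈ P, x ∈ A) →
      ∃ A ∈ P, (T : Set K) ⊆ A := by
    intro T
    induction T using Finset.induction_on with
    | empty => intro _; obtain ⟨A, hA⟩ := hne; exact ⟨A, hA, by simp⟩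
    | insert a s ha ih =>
      intro hT
      obtain ⟨A, hA, h1⟩ := ih (fun x hx => hT x (Finset.mem_insert_of_mem hx))
      obtain ⟨B, hB, h2⟩ := hT a (Finset.mem_insert_self _ _)
      obtain ⟨C, hC, hAC, hBC⟩ := hdir A hA B hB
      refine ⟨C, hC, ?_⟩
      rw [Finset.coe_insert, Set.insert_subset_iff]
      exact ⟨hBC h2, fun x hx => hAC (h1 hx)⟩
  obtain ⟨A, hA, h1⟩ := key S (fun x hx => h x (Submodule.subset_span hx))
  exact ⟨A, hA, Submodule.span_le.2 h1⟩

lemma aux_inv_ne_zero {J : FractionalIdeal R⁰ K} (hJ : J ≠ 0) : J⁻¹ ≠ 0 := by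
  intro h
  have := FractionalIdeal.bot_lt_mul_inv (K := K) hJ
  rw [h, mul_zero] at this
  exact lt_irrefl _ this

lemma aux_v_mono {I J : FractionalIdeal R⁰ K} (hI : I ≠ 0) (hIJ : I ≤ J) :
    (I⁻¹)⁻¹ ≤ (J⁻¹)⁻¹ := by
  have hJ : J ≠ 0 := by
    rintro rfl
    exact hI (le_antisymm hIJ (bot_le))
  exact FractionalIdeal.inv_anti_mono (aux_inv_ne_zero hJ) (aux_inv_ne_zero hI)
    (FractionalIdeal.inv_anti_mono hI hJ hIJ)

lemma aux_le_v {J : FractionalIdeal R⁰ K} (hJ : J ≠ 0) : J ≤ (J⁻¹)⁻¹ := by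
  intro x hx
  rw [FractionalIdeal.mem_inv_iff (aux_inv_ne_zero hJ)]
  intro y hy
  rw [mul_comm]
  exact (FractionalIdeal.mem_inv_iff hJ).1 hy x hx

lemma aux_v_v {J : FractionalIdeal R⁰ K} (hJ : J ≠ 0) :
    (((J⁻¹)⁻¹)⁻¹)⁻¹ ≤ (J⁻¹)⁻¹ := by
  have h1 := aux_inv_ne_zero hJ
  have h2 := aux_inv_ne_zero h1
  exact FractionalIdeal.inv_anti_mono h1 (aux_inv_ne_zero h2) (aux_le_v h1)

lemma aux_sup_fg {I J : FractionalIdeal R⁰ K} (hI : (I : Submodule R K).FG)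
    (hJ : (J : Submodule R K).FG) : ((I ⊔ J : FractionalIdeal R⁰ K) : Submodule R K).FG := by
  rw [FractionalIdeal.coe_sup]; exact hI.sup hJ

lemma aux_ne_zero_of_le {I J : FractionalIdeal R⁰ K} (hI : I ≠ 0) (hIJ : I ≤ J) : J ≠ 0 := by
  rintro rfl
  exact hI (le_antisymm hIJ (bot_le))

lemma aux_v_le_tOp {I J : FractionalIdeal R⁰ K} (hJ : J ≠ 0) (hJI : J ≤ I)
    (hfg : (J : Submodule R K).FG) :
    (((J⁻¹)⁻¹ : FractionalIdeal R⁰ K) : Submodule R K) ≤ tOp K I :=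
  le_iSup_of_le J (le_iSup_of_le hJ (le_iSup_of_le hJI (le_iSup_of_le hfg le_rfl)))

lemma aux_tOp_mono {I J : FractionalIdeal R⁰ K} (h : I ≤ J) : tOp K I ≤ tOp K J := by
  unfold tOp
  simp only [iSup_le_iff]
  intro A h1 h2 h3
  exact aux_v_le_tOp h1 (h2.trans h) h3

lemma aux_single {x : K} (hx : x ≠ 0) : FractionalIdeal.spanSingleton R⁰ x ≠ 0 ∧
    ((FractionalIdeal.spanSingleton R⁰ x : FractionalIdeal R⁰ K) : Submodule R K).FG := by
  refine ⟨FractionalIdeal.spanSingleton_ne_zero_iff.2 hx, ?_⟩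
  rw [FractionalIdeal.coe_spanSingleton]
  exact Submodule.fg_span_singleton x

lemma aux_le_tOp (I : FractionalIdeal R⁰ K) : (I : Submodule R K) ≤ tOp K I := by
  intro x hx
  by_cases h0 : x = 0
  · subst h0; exact Submodule.zero_mem _
  · obtain ⟨h1, h2⟩ := aux_single (R := R) h0
    have h3 := FractionalIdeal.spanSingleton_le_iff_mem.2 hx
    exact aux_v_le_tOp h1 h3 h2 (aux_le_v h1 (FractionalIdeal.mem_spanSingleton_self _ x))

lemma aux_mem_tOp {I : FractionalIdeal R⁰ K} (hI : I ≠ 0) {x : K} :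
    x ∈ tOp K I ↔ ∃ J : FractionalIdeal R⁰ K, J ≠ 0 ∧ J ≤ I ∧ (J : Submodule R K).FG ∧
      x ∈ (J⁻¹)⁻¹ := by
  constructor
  · let ι := {J : FractionalIdeal R⁰ K // J ≠ 0 ∧ J ≤ I ∧ (J : Submodule R K).FG}
    let S : ι → Submodule R K := fun J => (((J.1⁻¹)⁻¹ : FractionalIdeal R⁰ K) : Submodule R K)
    have hne : Nonempty ι := by
      obtain ⟨y, hy, hy0⟩ : ∃ y ∈ I, y ≠ 0 := by
        by_contra! h
        exact hI (FractionalIdeal.eq_zero_iff.2 h)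
      obtain ⟨h1, h2⟩ := aux_single (R := R) hy0
      exact ⟨⟨_, h1, FractionalIdeal.spanSingleton_le_iff_mem.2 hy, h2⟩⟩
    have hdir : Directed (· ≤ ·) S := by
      rintro ⟨A, a1, a2, a3⟩ ⟨B, b1, b2, b3⟩
      exact ⟨⟨A ⊔ B, aux_ne_zero_of_le a1 le_sup_left, sup_le a2 b2, aux_sup_fg a3 b3⟩,
        aux_v_mono a1 le_sup_left, aux_v_mono b1 le_sup_right⟩
    intro hx
    have : tOp K I ≤ iSup S := by
      unfold tOp
      simp only [iSup_le_iff]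
      intro A h1 h2 h3
      exact le_iSup S ⟨A, h1, h2, h3⟩
    obtain ⟨⟨J, h1, h2, h3⟩, h4⟩ := (Submodule.mem_iSup_of_directed S hdir).1 (this hx)
    exact ⟨J, h1, h2, h3, h4⟩
  · rintro ⟨J, h1, h2, h3, h4⟩
    exact aux_v_le_tOp h1 h2 h3 h4

lemma aux_isT_iff {N : Ideal R} : IsTIdeal K N ↔ ∀ J : FractionalIdeal R⁰ K, J ≠ 0 →
    J ≤ (N : FractionalIdeal R⁰ K) → (J : Submodule R K).FG →
      (J⁻¹)⁻¹ ≤ (N : FractionalIdeal R⁰ K) := by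
  constructor
  · intro h J h1 h2 h3 x hx
    have := aux_v_le_tOp h1 h2 h3 hx
    rw [h] at this
    exact this
  · intro h
    refine le_antisymm ?_ (aux_le_tOp _)
    unfold tOp
    simp only [iSup_le_iff]
    exact h

lemma aux_one_inv_inv : ((1 : FractionalIdeal R⁰ K)⁻¹)⁻¹ = 1 := by
  simp

lemma aux_tOp_le_one {I : FractionalIdeal R⁰ K} (h : I ≤ 1) : tOp K I ≤ 1 := by
  unfold tOp
  simp only [iSup_le_iff]
  intro A h1 h2 h3
  have := aux_v_mono h1 (h2.trans h)
  rw [aux_one_inv_inv] at this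
  rw [← FractionalIdeal.coe_one (S := R⁰)]
  exact this

/-- t-closure of an integral ideal as an ideal. -/
noncomputable def auxTc (K : Type*) [Field K]
    [Algebra R K] [IsFractionRing R K] (N : Ideal R) : Ideal R :=
  (tOp K (N : FractionalIdeal R⁰ K)).comap (Algebra.linearMap R K)

lemma aux_mem_tc {N : Ideal R} {r : R} :
    r ∈ auxTc K N ↔ algebraMap R K r ∈ tOp K (N : FractionalIdeal R⁰ K) := Iff.rfl

lemma aux_coe_tc (N : Ideal R) :
    ((auxTc K N : FractionalIdeal R⁰ K) : Submodule R K) = tOp K (N : FractionalIdeal R⁰ K) := by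
  apply le_antisymm
  · intro x hx
    obtain ⟨r, hr, rfl⟩ := (FractionalIdeal.mem_coeIdeal _).1 hx
    exact hr
  · intro x hx
    obtain ⟨r, rfl⟩ := Submodule.mem_one.1 (aux_tOp_le_one FractionalIdeal.coeIdeal_le_one hx)
    exact (FractionalIdeal.mem_coeIdeal _).2 ⟨r, hx, rfl⟩

lemma aux_le_tc (N : Ideal R) : N ≤ auxTc K N := by
  intro r hr
  exact aux_le_tOp _ ((FractionalIdeal.mem_coeIdeal _).2 ⟨r, hr, rfl⟩)

lemma aux_tc_isT {N : Ideal R} (hN : N ≠ ⊥) : IsTIdeal K (auxTc K N) := by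
  have hN' : (N : FractionalIdeal R⁰ K) ≠ 0 := FractionalIdeal.coeIdeal_ne_zero.2 hN
  rw [aux_isT_iff]
  intro J h1 h2 h3
  let P : Set (Submodule R K) := {A | ∃ F : FractionalIdeal R⁰ K, F ≠ 0 ∧
    F ≤ (N : FractionalIdeal R⁰ K) ∧ (F : Submodule R K).FG ∧
      A = (((F⁻¹)⁻¹ : FractionalIdeal R⁰ K) : Submodule R K)}
  have hmem : ∀ x ∈ (J : Submodule R K), ∃ A ∈ P, x ∈ A := by
    intro x hx
    have : x ∈ tOp K (N : FractionalIdeal R⁰ K) := by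
      rw [← aux_coe_tc]; exact h2 hx
    obtain ⟨F, f1, f2, f3, f4⟩ := (aux_mem_tOp hN').1 this
    exact ⟨_, ⟨F, f1, f2, f3, rfl⟩, f4⟩
  obtain ⟨A, ⟨F, f1, f2, f3, rfl⟩, hA⟩ := aux_fg_le P
    (by obtain ⟨A, hA, _⟩ := hmem 0 (Submodule.zero_mem _); exact ⟨A, hA⟩)
    (by
      rintro _ ⟨A, a1, a2, a3, rfl⟩ _ ⟨B, b1, b2, b3, rfl⟩
      exact ⟨_, ⟨A ⊔ B, aux_ne_zero_of_le a1 le_sup_left, sup_le a2 b2, aux_sup_fg a3 b3, rfl⟩,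
        aux_v_mono a1 le_sup_left, aux_v_mono b1 le_sup_right⟩)
    (J : Submodule R K) h3 hmem
  intro x hx
  have hx2 := aux_v_v f1 (aux_v_mono h1 hA hx)
  have := aux_v_le_tOp f1 f2 f3 hx2
  rw [← aux_coe_tc] at this
  exact this

lemma aux_exists_max {A : Ideal R} (hA : A ≠ ⊥) (h1 : (1 : R) ∉ auxTc K A) :
    ∃ M : Ideal R, IsMaxTIdeal K M ∧ A ≤ M := by
  let s : Set (Ideal R) := {N | N ≠ ⊤ ∧ IsTIdeal K N}
  obtain ⟨M, hM, hmax⟩ := zorn_le_nonempty₀ s (by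
    intro c hc hchain y hy
    have hdir : DirectedOn (· ≤ ·) c := hchain.directedOn
    refine ⟨sSup c, ⟨?_, ?_⟩, fun z hz => le_sSup hz⟩
    · intro h
      have : (1 : R) ∈ sSup c := by rw [h]; trivial
      obtain ⟨N, hN, h1N⟩ := (Submodule.mem_sSup_of_directed ⟨y, hy⟩ hdir).1 this
      exact (hc hN).1 ((Ideal.eq_top_iff_one _).2 h1N)
    · rw [aux_isT_iff]
      intro J j1 j2 j3
      let P : Set (Submodule R K) :=
        (fun N : Ideal R => ((N : FractionalIdeal R⁰ K) : Submodule R K)) '' c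
      obtain ⟨_, ⟨N, hN, rfl⟩, hJN⟩ := aux_fg_le P ⟨_, y, hy, rfl⟩ (by
          rintro _ ⟨A, ha, rfl⟩ _ ⟨B, hb, rfl⟩
          obtain ⟨C, hC, h1, h2⟩ := hdir A ha B hb
          exact ⟨_, ⟨C, hC, rfl⟩, (FractionalIdeal.coeIdeal_le_coeIdeal K).2 h1,
            (FractionalIdeal.coeIdeal_le_coeIdeal K).2 h2⟩) (J : Submodule R K) j3 (by
          intro x hx
          obtain ⟨r, hr, rfl⟩ := (FractionalIdeal.mem_coeIdeal _).1 (j2 hx)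
          obtain ⟨N, hN, hrN⟩ := (Submodule.mem_sSup_of_directed ⟨y, hy⟩ hdir).1 hr
          exact ⟨_, ⟨N, hN, rfl⟩, (FractionalIdeal.mem_coeIdeal _).2 ⟨r, hrN, rfl⟩⟩)
      exact (aux_isT_iff.1 (hc hN).2 J j1 hJN j3).trans
        ((FractionalIdeal.coeIdeal_le_coeIdeal K).2 (le_sSup hN)))
    (auxTc K A) ⟨fun h => h1 (by rw [h]; trivial), aux_tc_isT hA⟩
  refine ⟨M, ⟨hmax.1.1, hmax.1.2, fun N n1 n2 n3 => ?_⟩, (aux_le_tc A).trans hM⟩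
  exact le_antisymm n3 (hmax.2 ⟨n1, n2⟩ n3)

lemma aux_max_ne_bot (hnf : ¬ IsField R) {M : Ideal R} (hM : IsMaxTIdeal K M) : M ≠ ⊥ := by
  rintro rfl
  obtain ⟨a, ha0, hau⟩ := Ring.exists_not_isUnit_of_not_isField hnf
  have hspan : Ideal.span {a} ≠ (⊥ : Ideal R) := by simpa using ha0
  have ht : IsTIdeal K (Ideal.span {a}) := by
    rw [aux_isT_iff]
    intro J j1 j2 j3
    refine (aux_v_mono j1 j2).trans ?_
    rw [FractionalIdeal.coeIdeal_span_singleton]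
    simp
  exact hspan (hM.2.2 _ (by rwa [Ne, Ideal.span_singleton_eq_top]) ht bot_le).symm

lemma aux_max_prime (hnf : ¬ IsField R) {M : Ideal R} (hM : IsMaxTIdeal K M) : M.IsPrime := by
  have hb := aux_max_ne_bot hnf hM
  refine ⟨hM.1, ?_⟩
  intro a b hab
  by_contra! hcon
  obtain ⟨ha, hbM⟩ := hcon
  have hb0 : b ≠ 0 := by rintro rfl; exact hbM (Submodule.zero_mem _)
  let A : Ideal R := M ⊔ Ideal.span {a}
  have hA : A ≠ ⊥ := fun h => hb (le_bot_iff.1 (h ▸ le_sup_left))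
  have haA : a ∈ A := Ideal.mem_sup_right (Ideal.mem_span_singleton_self a)
  have htop : (1 : R) ∈ auxTc K A := by
    by_contra h1
    obtain ⟨N, hN, hAN⟩ := aux_exists_max hA h1
    have := hM.2.2 N hN.1 hN.2.1 (le_sup_left.trans hAN)
    exact ha (this ▸ hAN haA)
  rw [aux_mem_tc, aux_mem_tOp (FractionalIdeal.coeIdeal_ne_zero.2 hA), map_one] at htop
  obtain ⟨J, j1, j2, j3, j4⟩ := htop
  have hbK : algebraMap R K b ≠ 0 := by simpa using hb0
  let B : FractionalIdeal R⁰ K := FractionalIdeal.spanSingleton R⁰ (algebraMap R K b) * J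
  have hBmem : ∀ y ∈ J, algebraMap R K b * y ∈ B := fun y hy =>
    FractionalIdeal.mul_mem_mul (FractionalIdeal.mem_spanSingleton_self _ _) hy
  have hB0 : B ≠ 0 := by
    intro h
    apply j1
    rw [FractionalIdeal.eq_zero_iff]
    intro y hy
    have := FractionalIdeal.eq_zero_iff.1 h _ (hBmem y hy)
    simpa [hb0] using this
  have hBM : B ≤ (M : FractionalIdeal R⁰ K) := by
    rw [FractionalIdeal.spanSingleton_mul_le_iff]
    intro z hz
    obtain ⟨r, hr, rfl⟩ := (FractionalIdeal.mem_coeIdeal _).1 (j2 hz)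
    refine (FractionalIdeal.mem_coeIdeal _).2 ⟨b * r, ?_, by simp⟩
    obtain ⟨m, hm, n, hn, rfl⟩ := Submodule.mem_sup.1 hr
    obtain ⟨c, rfl⟩ := Ideal.mem_span_singleton'.1 hn
    rw [mul_add]
    refine M.add_mem (M.mul_mem_left _ hm) ?_
    have : b * (c * a) = c * (a * b) := by ring
    rw [this]
    exact M.mul_mem_left _ hab
  have hBfg : (B : Submodule R K).FG := by
    rw [FractionalIdeal.coe_mul, FractionalIdeal.coe_spanSingleton]
    exact (Submodule.fg_span_singleton _).mul j3
  have hbB : algebraMap R K b ∈ (B⁻¹)⁻¹ := by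
    rw [FractionalIdeal.mem_inv_iff (aux_inv_ne_zero hB0)]
    intro y hy
    rw [FractionalIdeal.mem_inv_iff hB0] at hy
    have h := (FractionalIdeal.mem_inv_iff (aux_inv_ne_zero j1)).1 j4 (algebraMap R K b * y) (by
      rw [FractionalIdeal.mem_inv_iff j1]
      intro z hz
      have := hy _ (hBmem z hz)
      convert this using 1; ring)
    simpa using h
  have := aux_isT_iff.1 hM.2.1 B hB0 hBM hBfg hbB
  obtain ⟨r, hr, hrb⟩ := (FractionalIdeal.mem_coeIdeal _).1 this
  rw [IsFractionRing.injective R K hrb] at hr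
  exact hbM hr

lemma aux_mem_loc {M : Ideal R} (hM : M.IsPrime) {A : Submodule R K} {x : K} :
    x ∈ locMul K M A ↔ ∃ t : R, t ∉ M ∧ t • x ∈ A := by
  have hne : ∀ t : R, t ∉ M → algebraMap R K t ≠ 0 := by
    intro t ht h
    have : t = 0 := by simpa using h
    exact ht (this ▸ M.zero_mem)
  constructor
  · intro hx
    let L : Submodule R K :=
      { carrier := {x | ∃ t : R, t ∉ M ∧ t • x ∈ A}
        zero_mem' := ⟨1, fun h => hM.ne_top ((Ideal.eq_top_iff_one _).2 h), by simp⟩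
        add_mem' := by
          rintro a b ⟨s, hs, hsa⟩ ⟨t, ht, htb⟩
          refine ⟨s * t, fun h => (hM.mem_or_mem h).elim hs ht, ?_⟩
          have : (s * t) • (a + b) = t • (s • a) + s • (t • b) := by
            simp only [Algebra.smul_def, map_mul]; ring
          rw [this]
          exact A.add_mem (A.smul_mem _ hsa) (A.smul_mem _ htb)
        smul_mem' := by
          rintro c a ⟨s, hs, hsa⟩
          exact ⟨s, hs, by rw [smul_comm]; exact A.smul_mem _ hsa⟩ }
    have hle : locMul K M A ≤ L := by
      unfold locMul
      simp only [iSup_le_iff]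
      intro t ht
      rw [Submodule.mul_le]
      intro m hm n hn
      obtain ⟨c, rfl⟩ := Submodule.mem_span_singleton.1 hm
      refine ⟨t, ht, ?_⟩
      have : t • (c • (algebraMap R K t)⁻¹ * n) = c • n := by
        have := hne t ht
        simp only [Algebra.smul_def]; field_simp
      rw [this]
      exact A.smul_mem _ hn
    exact hle hx
  · rintro ⟨t, ht, htx⟩
    have h1 : x = (algebraMap R K t)⁻¹ * (t • x) := by
      have := hne t ht
      simp only [Algebra.smul_def]; field_simp
    rw [h1]
    exact (le_iSup_of_le t (le_iSup_of_le ht le_rfl) :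
      Submodule.span R {(algebraMap R K t)⁻¹} * A ≤ locMul K M A)
      (Submodule.mul_mem_mul (Submodule.mem_span_singleton_self _) htx)

lemma aux_le_wOp (hnf : ¬ IsField R) (A : FractionalIdeal R⁰ K) :
    (A : Submodule R K) ≤ wOp K A := by
  unfold wOp
  simp only [le_iInf_iff]
  intro M hM x hx
  have hp := aux_max_prime hnf hM
  exact (aux_mem_loc hp).2
    ⟨1, fun h => hp.ne_top ((Ideal.eq_top_iff_one _).2 h), by simpa using hx⟩

lemma aux_wOp_loc (hnf : ¬ IsField R) {A B : FractionalIdeal R⁰ K} (h : wOp K A = wOp K B)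
    {M : Ideal R} (hM : IsMaxTIdeal K M) {x : K} (hx : x ∈ A) : ∃ t : R, t ∉ M ∧ t • x ∈ B := by
  have h1 : x ∈ wOp K B := h ▸ aux_le_wOp hnf A hx
  have h2 : wOp K B ≤ locMul K M (B : Submodule R K) := iInf₂_le M hM
  exact (aux_mem_loc (aux_max_prime hnf hM)).1 (h2 h1)

lemma aux_wOp_le (hnf : ¬ IsField R) {A B : FractionalIdeal R⁰ K}
    (h : ∀ M : Ideal R, IsMaxTIdeal K M → ∀ x ∈ A, ∃ t : R, t ∉ M ∧ t • x ∈ B) :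
    wOp K A ≤ wOp K B := by
  unfold wOp
  refine iInf₂_mono fun M hM => ?_
  have hp := aux_max_prime hnf hM
  intro x hx
  obtain ⟨s, hs, hsx⟩ := (aux_mem_loc hp).1 hx
  obtain ⟨t, ht, htx⟩ := h M hM _ hsx
  exact (aux_mem_loc hp).2 ⟨t * s, fun h => (hp.mem_or_mem h).elim ht hs, by
    rw [mul_smul]; exact htx⟩

lemma aux_mul_loc {M : Ideal R} (hM : M.IsPrime) {A B C : FractionalIdeal R⁰ K}
    (h : ∀ x ∈ A, ∃ t : R, t ∉ M ∧ t • x ∈ B) :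
    ∀ x ∈ A * C, ∃ t : R, t ∉ M ∧ t • x ∈ B * C := by
  intro x hx
  refine FractionalIdeal.mul_induction_on hx ?_ ?_
  · intro i hi j hj
    obtain ⟨t, ht, hti⟩ := h i hi
    refine ⟨t, ht, ?_⟩
    rw [← smul_mul_assoc]
    exact FractionalIdeal.mul_mem_mul hti hj
  · rintro a b ⟨s, hs, hsa⟩ ⟨t, ht, htb⟩
    refine ⟨s * t, fun h => (hM.mem_or_mem h).elim hs ht, ?_⟩
    have : (s * t) • (a + b) = t • (s • a) + s • (t • b) := by
      simp only [Algebra.smul_def, map_mul]; ring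
    rw [this]
    exact Submodule.add_mem (B * C : FractionalIdeal R⁰ K).coeToSubmodule
      (Submodule.smul_mem _ _ hsa) (Submodule.smul_mem _ _ htb)

lemma aux_forward (hnf : ¬ IsField R) (hP : IsPvMD (R := R) K) (I : Ideal R) (hI : I ≠ ⊥)
    (hfg : I.FG) (J : Ideal R) (hJI : J ≤ I) (n : ℕ)
    (h : wOp K ((J : FractionalIdeal R⁰ K) * (I : FractionalIdeal R⁰ K) ^ n)
              = wOp K ((I : FractionalIdeal R⁰ K) ^ (n + 1))) :
    wOp K (J : FractionalIdeal R⁰ K) = wOp K (I : FractionalIdeal R⁰ K) := by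
  apply le_antisymm
  · refine aux_wOp_le hnf fun M hM x hx =>
      ⟨1, fun h => hM.1 ((Ideal.eq_top_iff_one _).2 h), ?_⟩
    rw [one_smul]
    exact (FractionalIdeal.coeIdeal_le_coeIdeal K).2 hJI hx
  · refine aux_wOp_le hnf fun M hM x hx => ?_
    have hp := aux_max_prime hnf hM
    set I' : FractionalIdeal R⁰ K := (I : FractionalIdeal R⁰ K) with hI'
    have hle1 : I' * I'⁻¹ ≤ 1 := by
      rw [FractionalIdeal.inv_eq]; exact FractionalIdeal.mul_one_div_le_one
    obtain ⟨s, hs, hsM⟩ : ∃ s : R, algebraMap R K s ∈ I' * I'⁻¹ ∧ s ∉ M := by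
      by_contra! hcon
      have hle : I' * I'⁻¹ ≤ (M : FractionalIdeal R⁰ K) := by
        intro y hy
        obtain ⟨r, rfl⟩ := (FractionalIdeal.mem_one_iff _).1 (hle1 hy)
        exact (FractionalIdeal.mem_coeIdeal _).2 ⟨r, hcon r hy, rfl⟩
      have h1 : (1 : K) ∈ tOp K (I' * I'⁻¹) := by
        rw [hP I hI hfg]; exact Submodule.mem_one.2 ⟨1, by simp⟩
      have h2 := aux_tOp_mono hle h1
      rw [hM.2.1] at h2
      obtain ⟨r, hr, hr1⟩ := (FractionalIdeal.mem_coeIdeal _).1 h2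
      have : r = 1 := IsFractionRing.injective R K (by simpa using hr1)
      exact hM.1 ((Ideal.eq_top_iff_one _).2 (this ▸ hr))
    have hpow : ∀ k : ℕ, algebraMap R K s ^ k ∈ (I' * I'⁻¹) ^ k := by
      intro k
      induction k with
      | zero => simp
      | succ k ih => rw [pow_succ, pow_succ]; exact FractionalIdeal.mul_mem_mul ih hs
    have hx1 : x * algebraMap R K s ^ n ∈ I' ^ (n + 1) * (I'⁻¹) ^ n := by
      have := FractionalIdeal.mul_mem_mul hx (hpow n)
      rw [mul_pow] at this
      convert this using 1
      ring
    obtain ⟨t, ht, htx⟩ := aux_mul_loc hp (C := (I'⁻¹) ^ n)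
      (fun y hy => aux_wOp_loc hnf h.symm hM hy) _ hx1
    have hfin : (J : FractionalIdeal R⁰ K) * I' ^ n * (I'⁻¹) ^ n ≤ J := by
      rw [mul_assoc, ← mul_pow]
      calc (J : FractionalIdeal R⁰ K) * (I' * I'⁻¹) ^ n ≤ J * 1 := by
            gcongr
            exact pow_le_one' hle1 n
        _ = J := mul_one _
    refine ⟨t * s ^ n, fun h => (hp.mem_or_mem h).elim ht
      (fun h => hsM (hp.mem_of_pow_mem _ h)), ?_⟩
    have h3 := hfin htx
    convert h3 using 1
    simp only [Algebra.smul_def, map_mul, map_pow]; ring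

/-- the finite `w`-basic property -/
def AuxBasic (R K : Type*) [CommRing R] [IsDomain R] [Field K] [Algebra R K]
    [IsFractionRing R K] : Prop :=
  ∀ I : Ideal R, I ≠ ⊥ → I.FG →
        ∀ J : Ideal R, J ≠ ⊥ → J ≤ I →
          (∃ n : ℕ, wOp K ((J : FractionalIdeal R⁰ K) * (I : FractionalIdeal R⁰ K) ^ n)
              = wOp K ((I : FractionalIdeal R⁰ K) ^ (n + 1))) →
          wOp K (J : FractionalIdeal R⁰ K) = wOp K (I : FractionalIdeal R⁰ K)

lemma aux_basic_use (hnf : ¬ IsField R) (hB : AuxBasic R K) {I J : Ideal R} (hI : I.FG)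
    (hJ0 : J ≠ ⊥) (hJI : J ≤ I) (h : I * I ≤ J * I) {M : Ideal R} (hM : IsMaxTIdeal K M)
    {x : R} (hx : x ∈ I) : ∃ t : R, t ∉ M ∧ t * x ∈ J := by
  have heq : J * I = I * I := le_antisymm (Ideal.mul_mono_left hJI) h
  have hw := hB I (fun h => hJ0 (le_bot_iff.1 (h ▸ hJI))) hI J hJ0 hJI ⟨1, by
    rw [pow_one, pow_two, ← FractionalIdeal.coeIdeal_mul, ← FractionalIdeal.coeIdeal_mul, heq]⟩
  obtain ⟨t, ht, htx⟩ := aux_wOp_loc hnf hw.symm hM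
    ((FractionalIdeal.mem_coeIdeal R⁰ (P := K)).2 ⟨x, hx, rfl⟩)
  refine ⟨t, ht, ?_⟩
  obtain ⟨r, hr, hrx⟩ := (FractionalIdeal.mem_coeIdeal _).1 htx
  have : r = t * x := IsFractionRing.injective R K (by rw [hrx, Algebra.smul_def, map_mul])
  exact this ▸ hr

lemma aux_val (hnf : ¬ IsField R) (hB : AuxBasic R K) {M : Ideal R} (hM : IsMaxTIdeal K M)
    (a b : R) : ∃ t : R, t ∉ M ∧ (b ∣ t * a ∨ a ∣ t * b) := by
  have hp := aux_max_prime hnf hM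
  have h1M : (1 : R) ∉ M := fun h => hM.1 ((Ideal.eq_top_iff_one _).2 h)
  by_cases hb : b = 0
  · exact ⟨1, h1M, Or.inr (by simp [hb])⟩
  -- first step
  obtain ⟨t, ht, r, s, hrs⟩ : ∃ t : R, t ∉ M ∧ ∃ r s : R, t * (a * b) = r * a ^ 2 + s * b ^ 2 := by
    obtain ⟨t, ht, h⟩ := aux_basic_use hnf hB (I := Ideal.span {a ^ 2, a * b, b ^ 2})
      (J := Ideal.span {a ^ 2, b ^ 2}) (x := a * b) (Submodule.fg_span (by simp))
      (by
        intro h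
        have : b ^ 2 ∈ (⊥ : Ideal R) := h ▸ Ideal.subset_span (by simp)
        exact hb (by simpa using this))
      (Ideal.span_mono (by
        intro x hx
        simp only [Set.mem_insert_iff, Set.mem_singleton_iff] at hx ⊢
        tauto))
      (by
        have e1 : ∀ x ∈ ({a ^ 2, a * b, b ^ 2} : Set R), ∀ y ∈ ({a ^ 2, b ^ 2} : Set R),
            y * x ∈ Ideal.span ({a ^ 2, b ^ 2} : Set R) * Ideal.span {a ^ 2, a * b, b ^ 2} :=
          fun x hx y hy => Ideal.mul_mem_mul (Ideal.subset_span hy) (Ideal.subset_span hx)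
        rw [Ideal.span_mul_span' {a ^ 2, a * b, b ^ 2}, Ideal.span_le]
        rintro _ ⟨x, hx, y, hy, rfl⟩
        simp only [Set.mem_insert_iff, Set.mem_singleton_iff] at hx hy
        show x * y ∈ _
        rcases hx with rfl | rfl | rfl
        · exact e1 y (by simpa using hy) _ (by simp)
        · rcases hy with rfl | rfl | rfl
          · rw [mul_comm (a * b)]; exact e1 (a * b) (by simp) (a ^ 2) (by simp)
          · have : a * b * (a * b) = a ^ 2 * b ^ 2 := by ring
            rw [this]; exact e1 _ (by simp) _ (by simp)
          · rw [mul_comm (a * b)]; exact e1 (a * b) (by simp) (b ^ 2) (by simp)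
        · exact e1 y (by simpa using hy) _ (by simp))
      hM (Ideal.subset_span (by simp))
    obtain ⟨r, s, h⟩ := Ideal.mem_span_pair.1 h
    exact ⟨t, ht, r, s, h.symm⟩
  -- second step
  obtain ⟨u, hu, d, hd⟩ : ∃ u : R, u ∉ M ∧ b ∣ u * (r * a) := by
    obtain ⟨u, hu, h⟩ := aux_basic_use hnf hB (I := Ideal.span {r * a, b})
      (J := Ideal.span {b}) (x := r * a) (Submodule.fg_span (by simp))
      (by simpa using hb) (Ideal.span_mono (by simp))
      (by
        rw [Ideal.span_mul_span' {r * a, b}, Ideal.span_le]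
        rintro _ ⟨x, hx, y, hy, rfl⟩
        simp only [Set.mem_insert_iff, Set.mem_singleton_iff] at hx hy
        show x * y ∈ Ideal.span {b} * _
        rw [Ideal.mem_span_singleton_mul]
        rcases hx with rfl | rfl
        · rcases hy with rfl | rfl
          · refine ⟨t * (r * a) - r * s * b, ?_, by linear_combination r * hrs⟩
            exact Ideal.sub_mem _ (Ideal.mul_mem_left _ _ (Ideal.subset_span (by simp)))
              (Ideal.mul_mem_left _ _ (Ideal.subset_span (by simp)))
          · exact ⟨r * a, Ideal.subset_span (by simp), by ring⟩
        · exact ⟨y, Ideal.subset_span (by simpa using hy), rfl⟩)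
      hM (Ideal.subset_span (by simp))
    exact ⟨u, hu, Ideal.mem_span_singleton.1 h⟩
  by_cases hcase : u * t - d ∈ M
  · refine ⟨d, ?_, Or.inr ⟨u * r, by linear_combination -hd⟩⟩
    intro hdM
    have : u * t ∈ M := by simpa using M.add_mem hcase hdM
    exact (hp.mem_or_mem this).elim hu ht
  · refine ⟨u * t - d, hcase, Or.inl ⟨u * s, ?_⟩⟩
    apply mul_left_cancel₀ hb
    linear_combination u * hrs + a * hd

/-- finitely generated ideals are locally principal -/
lemma aux_locprinc (hnf : ¬ IsField R) (hB : AuxBasic R K) {M : Ideal R} (hM : IsMaxTIdeal K M)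
    (S : Finset R) (hS : S.Nonempty) :
    ∃ a ∈ S, ∃ t : R, t ∉ M ∧ ∀ x ∈ S, a ∣ t * x := by
  classical
  have hp := aux_max_prime hnf hM
  have h1M : (1 : R) ∉ M := fun h => hM.1 ((Ideal.eq_top_iff_one _).2 h)
  induction hS using Finset.Nonempty.cons_induction with
  | singleton a => exact ⟨a, by simp, 1, h1M, by simp⟩
  | cons b s hb hs ih =>
    obtain ⟨a, ha, t, ht, hdiv⟩ := ih
    obtain ⟨u, hu, h⟩ := aux_val hnf hB hM a b
    have hut : u * t ∉ M := fun h => (hp.mem_or_mem h).elim hu ht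
    rcases h with h | h
    · refine ⟨b, by simp, u * t, hut, ?_⟩
      intro x hx
      rw [Finset.mem_cons] at hx
      rcases hx with rfl | hx
      · exact dvd_mul_left _ _
      · obtain ⟨c, hc⟩ := hdiv x hx
        rw [mul_assoc, hc, ← mul_assoc]
        exact dvd_mul_of_dvd_left h _
    · refine ⟨a, by simp [ha], u * t, hut, ?_⟩
      intro x hx
      rw [Finset.mem_cons] at hx
      rcases hx with rfl | hx
      · rw [mul_right_comm]; exact dvd_mul_of_dvd_left h _
      · rw [mul_assoc]; exact dvd_mul_of_dvd_right (hdiv x hx) _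

lemma aux_backward (hnf : ¬ IsField R) (hB : AuxBasic R K) : IsPvMD (R := R) K := by
  intro I hI hfg
  set I' : FractionalIdeal R⁰ K := (I : FractionalIdeal R⁰ K) with hI'
  have hI0 : I' ≠ 0 := FractionalIdeal.coeIdeal_ne_zero.2 hI
  have hle1 : I' * I'⁻¹ ≤ 1 := by
    rw [FractionalIdeal.inv_eq]; exact FractionalIdeal.mul_one_div_le_one
  obtain ⟨A, hA⟩ := FractionalIdeal.le_one_iff_exists_coeIdeal.1 hle1
  have hA0 : A ≠ ⊥ := by
    rw [← FractionalIdeal.coeIdeal_ne_zero (K := K), hA]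
    exact (FractionalIdeal.bot_lt_mul_inv (K := K) hI0).ne'
  have h1 : (1 : R) ∈ auxTc K A := by
    by_contra h1
    obtain ⟨M, hM, hAM⟩ := aux_exists_max hA0 h1
    have hp := aux_max_prime hnf hM
    obtain ⟨S, hS⟩ := hfg
    have hSne : S.Nonempty := by
      rw [Finset.nonempty_iff_ne_empty]
      rintro rfl
      exact hI (by rw [← hS]; simp)
    obtain ⟨a, ha, t, ht, hdiv⟩ := aux_locprinc hnf hB hM S hSne
    have haI : a ∈ I := by rw [← hS]; exact Submodule.subset_span ha
    have hdivI : ∀ x ∈ I, a ∣ t * x := by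
      intro x hx
      rw [← hS] at hx
      refine Submodule.span_induction (p := fun x _ => a ∣ t * x) hdiv (by simp) ?_ ?_ hx
      · intro x y _ _ h1 h2; rw [mul_add]; exact dvd_add h1 h2
      · intro c x _ h; rw [smul_eq_mul, mul_left_comm]; exact dvd_mul_of_dvd_right h _
    have ha0 : a ≠ 0 := by
      rintro rfl
      apply hI
      rw [eq_bot_iff]
      intro x hx
      have h2 := zero_dvd_iff.1 (hdivI x hx)
      rcases mul_eq_zero.1 h2 with h3 | h3
      · exact absurd (h3 ▸ M.zero_mem) ht
      · simpa using h3
    have haK : algebraMap R K a ≠ 0 := by simpa using ha0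
    have hinv : algebraMap R K t / algebraMap R K a ∈ I'⁻¹ := by
      rw [FractionalIdeal.mem_inv_iff hI0]
      intro y hy
      obtain ⟨x, hx, rfl⟩ := (FractionalIdeal.mem_coeIdeal _).1 hy
      obtain ⟨c, hc⟩ := hdivI x hx
      refine (FractionalIdeal.mem_one_iff _).2 ⟨c, ?_⟩
      have hc' := congrArg (algebraMap R K) hc
      simp only [map_mul] at hc'
      field_simp
      rw [hc', mul_comm]
    have hmem := FractionalIdeal.mul_mem_mul
      ((FractionalIdeal.mem_coeIdeal R⁰ (P := K)).2 ⟨a, haI, rfl⟩) hinv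
    rw [mul_div_cancel₀ _ haK] at hmem
    rw [← hI', ← hA] at hmem
    obtain ⟨r, hr, hrt⟩ := (FractionalIdeal.mem_coeIdeal _).1 hmem
    rw [IsFractionRing.injective R K hrt] at hr
    exact ht (hAM hr)
  apply le_antisymm (aux_tOp_le_one hle1)
  rw [Submodule.one_le, ← hA]
  simpa [aux_mem_tc] using h1

end helpers

/-- An integral domain `R` (not a field) is a Prüfer `v`-multiplication domain if and only if
`R` has the finite `w`-basic ideal property: every nonzero finitely generated ideal of `R` is
`w`-basic. -/
theorem isPvMD_iff_finite_w_basic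
    {R K : Type*} [CommRing R] [IsDomain R] [Field K] [Algebra R K] [IsFractionRing R K]
    (hnf : ¬ IsField R) :
    IsPvMD (R := R) K ↔
      (∀ I : Ideal R, I ≠ ⊥ → I.FG →
        ∀ J : Ideal R, J ≠ ⊥ → J ≤ I →
          (∃ n : ℕ, wOp K ((J : FractionalIdeal R⁰ K) * (I : FractionalIdeal R⁰ K) ^ n)
              = wOp K ((I : FractionalIdeal R⁰ K) ^ (n + 1))) →
          wOp K (J : FractionalIdeal R⁰ K) = wOp K (I : FractionalIdeal R⁰ K)) := by
  constructor
  · rintro hP I hI hfg J _ hJI ⟨n, h⟩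
    exact aux_forward hnf hP I hI hfg J hJI n h
  · intro hB
    exact aux_backward hnf hB
end

section
/- Let R be a Prüfer v-multiplication domain that is not a field, let x be a nonzero nonunit of R, let P be a prime ideal of R minimal over xR, and let I = xR_P ∩ R. Then (1) I is a w-ideal of R, i.e., I_w = I, and (2) xR + I² is a w-reduction of I. -/
open scoped nonZeroDivisors

/-- The ideal `x·R_P ∩ R` of `R`: the contraction to `R` of the extension of `xR` to the
localization `R_P ⊆ K`. -/
noncomputable def contrLoc {R : Type*} (K : Type*) [CommRing R] [IsDomain R] [Field K]
    [Algebra R K] [IsFractionRing R K] (P : Ideal R) (x : R) : Ideal R :=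
  (locMul K P (Submodule.map (Algebra.linearMap R K) (Ideal.span {x}))).comap
    (Algebra.linearMap R K)

section helpers

set_option linter.unusedSectionVars false

variable {R : Type*} (K : Type*) [CommRing R] [IsDomain R] [Field K]
  [Algebra R K] [IsFractionRing R K]

lemma mem_locMul' (M : Ideal R) (hM : M.IsPrime) (A : Submodule R K) (y : K) :
    y ∈ locMul K M A ↔ ∃ t, t ∉ M ∧ algebraMap R K t * y ∈ A := by
  constructor
  · let B : Submodule R K :=
      { carrier := {y | ∃ t, t ∉ M ∧ algebraMap R K t * y ∈ A}
        zero_mem' := ⟨1, fun h => hM.ne_top ((Ideal.eq_top_iff_one _).2 h), by simp⟩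
        add_mem' := by
          rintro a b ⟨t, ht, hta⟩ ⟨s, hs, hsb⟩
          refine ⟨t * s, fun h => (hM.mem_or_mem h).elim ht hs, ?_⟩
          have h1 := A.smul_mem s hta
          have h2 := A.smul_mem t hsb
          rw [Algebra.smul_def] at h1 h2
          convert A.add_mem h1 h2 using 1
          rw [map_mul]; ring
        smul_mem' := by
          rintro c a ⟨t, ht, hta⟩
          refine ⟨t, ht, ?_⟩
          have h1 := A.smul_mem c hta
          rw [Algebra.smul_def] at h1 ⊢
          convert h1 using 1
          ring }
    have hle : locMul K M A ≤ B := by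
      refine iSup_le fun t => iSup_le fun ht => ?_
      intro z hz
      obtain ⟨a, ha, rfl⟩ := Submodule.mem_span_singleton_mul.1 hz
      refine ⟨t, ht, ?_⟩
      have h0 : algebraMap R K t ≠ 0 := by
        intro h
        have : t = 0 := (IsFractionRing.injective R K) (by simpa using h)
        exact ht (this ▸ M.zero_mem)
      rw [mul_inv_cancel_left₀ h0]
      exact ha
    exact fun h => hle h
  · rintro ⟨t, ht, hy⟩
    have h0 : algebraMap R K t ≠ 0 := by
      intro h
      have : t = 0 := (IsFractionRing.injective R K) (by simpa using h)
      exact ht (this ▸ M.zero_mem)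
    refine Submodule.mem_iSup_of_mem t (Submodule.mem_iSup_of_mem ht ?_)
    exact Submodule.mem_span_singleton_mul.2 ⟨_, hy, by rw [inv_mul_cancel_left₀ h0]⟩

/-- Glaz-Vasconcelos type ideals. -/
def IsGV (J : Ideal R) : Prop :=
  ∀ y : K, (∀ j ∈ J, ∃ r, algebraMap R K r = y * algebraMap R K j) → ∃ r, algebraMap R K r = y

variable {K}

lemma IsGV.mono {J J' : Ideal R} (h : IsGV K J) (hle : J ≤ J') : IsGV K J' :=
  fun y hy => h y fun j hj => hy j (hle hj)

lemma IsGV.mul {J J' : Ideal R} (h : IsGV K J) (h' : IsGV K J') : IsGV K (J * J') := by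
  intro y hy
  refine h y fun j hj => h' _ fun j' hj' => ?_
  obtain ⟨r, hr⟩ := hy _ (Ideal.mul_mem_mul hj hj')
  exact ⟨r, by rw [hr, map_mul]; ring⟩

lemma IsGV.top : IsGV K (⊤ : Ideal R) := by
  intro y hy
  obtain ⟨r, hr⟩ := hy 1 trivial
  exact ⟨r, by simpa using hr⟩

lemma IsGV.pow {J : Ideal R} (h : IsGV K J) (n : ℕ) : IsGV K (J ^ n) := by
  induction n with
  | zero => rw [pow_zero, Ideal.one_eq_top]; exact IsGV.top
  | succ n ih => rw [pow_succ]; exact ih.mul h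

lemma IsGV.ne_bot (hnf : ¬ IsField R) {J : Ideal R} (h : IsGV K J) : J ≠ ⊥ := by
  rintro rfl
  apply hnf
  have hs : Function.Surjective (algebraMap R K) := fun y => h y fun j hj => ⟨0, by
    rw [Ideal.mem_bot] at hj; simp [hj]⟩
  exact (MulEquiv.ofBijective (algebraMap R K) ⟨IsFractionRing.injective R K, hs⟩).isField
    (Field.toIsField K)

variable (K)

/-- No finitely generated GV subideal. -/
def noGV (N : Ideal R) : Prop := ∀ J : Ideal R, J.FG → J ≤ N → ¬ IsGV K J

lemma noGV_of_t (hnf : ¬ IsField R) (M : Ideal R) (hM : M ≠ ⊤) (ht : IsTIdeal K M) :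
    noGV K M := by
  intro J hfg hle hgv
  apply hM
  rw [Ideal.eq_top_iff_one]
  have hJ : (J : FractionalIdeal R⁰ K) ≠ 0 := by
    rw [Ne, FractionalIdeal.coeIdeal_eq_zero]; exact hgv.ne_bot hnf
  have h1 : (1 : K) ∈ (J : FractionalIdeal R⁰ K)⁻¹ := by
    rw [FractionalIdeal.mem_inv_iff hJ]
    intro y hy
    rw [one_mul]
    exact FractionalIdeal.coeIdeal_le_one hy
  have hJi : (J : FractionalIdeal R⁰ K)⁻¹ ≠ 0 := by
    intro h; rw [h] at h1; simp at h1
  have h2 : (1 : K) ∈ ((J : FractionalIdeal R⁰ K)⁻¹)⁻¹ := by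
    rw [FractionalIdeal.mem_inv_iff hJi]
    intro y hy
    rw [FractionalIdeal.mem_inv_iff hJ] at hy
    rw [one_mul, FractionalIdeal.mem_one_iff]
    refine hgv y fun j hj => ?_
    exact (FractionalIdeal.mem_one_iff _).1
      (hy _ (FractionalIdeal.mem_coeIdeal_of_mem _ hj))
  have h3 : (1 : K) ∈ tOp K (M : FractionalIdeal R⁰ K) := by
    refine Submodule.mem_iSup_of_mem (J : FractionalIdeal R⁰ K) ?_
    refine Submodule.mem_iSup_of_mem hJ (Submodule.mem_iSup_of_mem ?_
      (Submodule.mem_iSup_of_mem ?_ h2))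
    · exact (FractionalIdeal.coeIdeal_le_coeIdeal K).2 hle
    · exact (FractionalIdeal.coeIdeal_fg _ (IsFractionRing.injective R K) _).2 hfg
  rw [ht] at h3
  obtain ⟨m, hm, hm1⟩ := (FractionalIdeal.mem_coeIdeal _).1 h3
  have : m = 1 := IsFractionRing.injective R K (by simpa using hm1)
  exact this ▸ hm

lemma exists_fg_le (M N L : Ideal R) (hL : L.FG) :
    L ≤ M ⊔ N → ∃ J : Ideal R, J.FG ∧ J ≤ M ∧ L ≤ J ⊔ N := by
  induction L, hL using Submodule.fg_induction with
  | singleton z =>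
    intro h
    obtain ⟨m, hm, n, hn, hz⟩ := Submodule.mem_sup.1 (h (Submodule.mem_span_singleton_self z))
    refine ⟨Ideal.span {m}, Submodule.fg_span_singleton m,
      (Ideal.span_singleton_le_iff_mem M).2 hm, (Ideal.span_singleton_le_iff_mem _).2 ?_⟩
    exact Submodule.mem_sup.2 ⟨m, Ideal.mem_span_singleton_self m, n, hn, hz⟩
  | sup A B _ _ hA hB =>
    intro h
    obtain ⟨J1, f1, l1, k1⟩ := hA (le_sup_left.trans h)
    obtain ⟨J2, f2, l2, k2⟩ := hB (le_sup_right.trans h)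
    exact ⟨J1 ⊔ J2, Submodule.FG.sup f1 f2, sup_le l1 l2,
      sup_le (k1.trans (sup_le_sup_right le_sup_left _))
        (k2.trans (sup_le_sup_right le_sup_right _))⟩

lemma exists_max (N : Ideal R) (hN : noGV K N) : ∃ M, N ≤ M ∧ Maximal (noGV K) M := by
  refine zorn_le_nonempty₀ {N | noGV K N} ?_ N hN
  intro c hc hch y hy
  refine ⟨sSup c, ?_, fun z hz => le_sSup hz⟩
  intro J hfg hle
  obtain ⟨A, hA, hJA⟩ := (CompleteLattice.isCompactElement_iff_le_of_directed_sSup_le _ _).1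
    ((Submodule.fg_iff_compact J).1 hfg) c ⟨y, hy⟩ hch.directedOn hle
  exact hc hA J hfg hJA

lemma gv_of_max {M : Ideal R} (hM : Maximal (noGV K) M) {y : R} (hy : y ∉ M) :
    ∃ L : Ideal R, L.FG ∧ L ≤ M ⊔ Ideal.span {y} ∧ IsGV K L := by
  by_contra hcon
  push Not at hcon
  exact hy (hM.2 (y := M ⊔ Ideal.span {y}) hcon le_sup_left
    (Ideal.mem_sup_right (Ideal.mem_span_singleton_self y)))

lemma noGV_ne_top {M : Ideal R} (hM : noGV K M) : M ≠ ⊤ := by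
  rintro rfl
  exact hM ⊤ ⟨{1}, by simp⟩ le_rfl IsGV.top

lemma max_prime {M : Ideal R} (hM : Maximal (noGV K) M) : M.IsPrime := by
  refine ⟨noGV_ne_top K hM.1, ?_⟩
  intro a b hab
  by_contra hcon
  push Not at hcon
  obtain ⟨L1, f1, l1, g1⟩ := gv_of_max K hM hcon.1
  obtain ⟨L2, f2, l2, g2⟩ := gv_of_max K hM hcon.2
  refine hM.1 _ (Ideal.FG.mul f1 f2) ((Ideal.mul_mono l1 l2).trans ?_) (g1.mul g2)
  rw [Ideal.sup_mul, Ideal.mul_sup, Ideal.mul_sup, Ideal.span_singleton_mul_span_singleton]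
  refine sup_le (sup_le (Ideal.mul_le.2 fun r hr s _ => M.mul_mem_right s hr)
    (Ideal.mul_le.2 fun r hr s _ => M.mul_mem_right s hr))
    (sup_le (Ideal.mul_le.2 fun r _ s hs => M.mul_mem_left r hs) ((Ideal.span_singleton_le_iff_mem M).2 hab))

lemma max_t (hnf : ¬ IsField R) {M : Ideal R} (hM : Maximal (noGV K) M) : IsMaxTIdeal K M := by
  have hinj := IsFractionRing.injective R K
  refine ⟨noGV_ne_top K hM.1, ?_, fun N hN hNt hle =>
    le_antisymm hle (hM.2 (noGV_of_t K hnf N hN hNt) hle)⟩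
  apply le_antisymm
  · refine iSup_le fun J => iSup_le fun hJ0 => iSup_le fun hJM => iSup_le fun hfg => ?_
    obtain ⟨J, rfl⟩ := FractionalIdeal.le_one_iff_exists_coeIdeal.1
      (hJM.trans FractionalIdeal.coeIdeal_le_one)
    rw [FractionalIdeal.coeIdeal_le_coeIdeal] at hJM
    rw [FractionalIdeal.coeIdeal_fg _ hinj] at hfg
    intro y hy
    have h1 : (1 : K) ∈ (J : FractionalIdeal R⁰ K)⁻¹ := by
      rw [FractionalIdeal.mem_inv_iff hJ0]
      intro y hy
      rw [one_mul]
      exact FractionalIdeal.coeIdeal_le_one hy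
    have hJi : (J : FractionalIdeal R⁰ K)⁻¹ ≠ 0 := by
      intro h; rw [h] at h1; simp at h1
    have hy' := (FractionalIdeal.mem_inv_iff hJi).1 hy
    obtain ⟨r, hr⟩ := (FractionalIdeal.mem_one_iff _).1 (hy' 1 h1)
    rw [mul_one] at hr
    subst hr
    refine (FractionalIdeal.mem_coeIdeal _).2 ⟨r, ?_, rfl⟩
    by_contra hrM
    obtain ⟨L, fL, lL, gL⟩ := gv_of_max K hM hrM
    obtain ⟨J', f', l', k'⟩ := exists_fg_le M (Ideal.span {r}) L fL lL
    refine hM.1 (J ⊔ J') (Submodule.FG.sup hfg f') (sup_le hJM l') ?_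
    intro z hz
    refine gL z fun j hj => ?_
    obtain ⟨a, ha, b, hb, rfl⟩ := Submodule.mem_sup.1 (k' hj)
    obtain ⟨c, rfl⟩ := Ideal.mem_span_singleton'.1 hb
    obtain ⟨u, hu⟩ := hz a (Ideal.mem_sup_right ha)
    have hzJ : z ∈ (J : FractionalIdeal R⁰ K)⁻¹ := by
      rw [FractionalIdeal.mem_inv_iff hJ0]
      intro w hw
      obtain ⟨w', hw', rfl⟩ := (FractionalIdeal.mem_coeIdeal _).1 hw
      exact (FractionalIdeal.mem_one_iff _).2 (hz w' (Ideal.mem_sup_left hw'))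
    obtain ⟨v, hv⟩ := (FractionalIdeal.mem_one_iff _).1 (hy' z hzJ)
    refine ⟨u + c * v, ?_⟩
    rw [map_add, map_mul, hu, hv, map_add, map_mul]
    ring
  · intro y hy
    obtain ⟨m, hm, rfl⟩ := (FractionalIdeal.mem_coeIdeal _).1 hy
    by_cases hm0 : m = 0
    · subst hm0; simp
    have hJ : ((Ideal.span {m} : Ideal R) : FractionalIdeal R⁰ K) ≠ 0 := by
      rw [Ne, FractionalIdeal.coeIdeal_eq_zero, Ideal.span_singleton_eq_bot]; exact hm0
    refine Submodule.mem_iSup_of_mem ((Ideal.span {m} : Ideal R) : FractionalIdeal R⁰ K) ?_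
    refine Submodule.mem_iSup_of_mem hJ (Submodule.mem_iSup_of_mem ?_
      (Submodule.mem_iSup_of_mem ?_ ?_))
    · exact (FractionalIdeal.coeIdeal_le_coeIdeal K).2
        ((Ideal.span_singleton_le_iff_mem M).2 hm)
    · exact (FractionalIdeal.coeIdeal_fg _ hinj _).2 (Submodule.fg_span_singleton m)
    · rw [FractionalIdeal.mem_coe]
      have h1 : (1 : K) ∈ ((Ideal.span {m} : Ideal R) : FractionalIdeal R⁰ K)⁻¹ := by
        rw [FractionalIdeal.mem_inv_iff hJ]
        intro y hy
        rw [one_mul]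
        exact FractionalIdeal.coeIdeal_le_one hy
      have hJi : ((Ideal.span {m} : Ideal R) : FractionalIdeal R⁰ K)⁻¹ ≠ 0 := by
        intro h; rw [h] at h1; simp at h1
      rw [FractionalIdeal.mem_inv_iff hJi]
      intro z hz
      rw [mul_comm]
      exact (FractionalIdeal.mem_inv_iff hJ).1 hz _
        (FractionalIdeal.mem_coeIdeal_of_mem _ (Ideal.mem_span_singleton_self m))

lemma maximal_of_max_t (hnf : ¬ IsField R) {M : Ideal R} (hM : IsMaxTIdeal K M) :
    Maximal (noGV K) M := by
  obtain ⟨M', hle, hM'⟩ := exists_max K M (noGV_of_t K hnf M hM.1 hM.2.1)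
  have h := max_t K hnf hM'
  rw [hM.2.2 M' h.1 h.2.1 hle]
  exact hM'

lemma exists_gv (hnf : ¬ IsField R) (N : Ideal R) (h : ∀ M, IsMaxTIdeal K M → ¬ N ≤ M) :
    ∃ J : Ideal R, J.FG ∧ J ≤ N ∧ IsGV K J := by
  by_contra hcon
  push Not at hcon
  obtain ⟨M, hle, hM⟩ := exists_max K N hcon
  exact h M (max_t K hnf hM) hle

lemma tOp_mono {A B : FractionalIdeal R⁰ K} (h : A ≤ B) : tOp K A ≤ tOp K B := by
  refine iSup_le fun J => iSup_le fun hJ0 => iSup_le fun hJM => iSup_le fun hfg => ?_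
  intro y hy
  exact Submodule.mem_iSup_of_mem J (Submodule.mem_iSup_of_mem hJ0
    (Submodule.mem_iSup_of_mem (hJM.trans h) (Submodule.mem_iSup_of_mem hfg hy)))

lemma val_of_pvmd (hp : IsPvMD (R := R) K) {M : Ideal R} (hM : IsMaxTIdeal K M) (a b : R)
    (ha : a ≠ 0) : ∃ t, t ∉ M ∧ ((∃ c, t * a = c * b) ∨ ∃ c, t * b = c * a) := by
  have hinj := IsFractionRing.injective R K
  by_contra hcon
  push Not at hcon
  have hne : Ideal.span {a, b} ≠ (⊥ : Ideal R) := by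
    intro h
    exact ha (Ideal.mem_bot.1 (h ▸ Ideal.subset_span (by simp)))
  have hne' : ((Ideal.span {a, b} : Ideal R) : FractionalIdeal R⁰ K) ≠ 0 := by
    rwa [Ne, FractionalIdeal.coeIdeal_eq_zero]
  have h1 := hp (Ideal.span {a, b}) hne (Submodule.fg_span (Set.toFinite _))
  have hle : ((Ideal.span {a, b} : Ideal R) : FractionalIdeal R⁰ K)
      * ((Ideal.span {a, b} : Ideal R) : FractionalIdeal R⁰ K)⁻¹ ≤ (M : FractionalIdeal R⁰ K) := by
    rw [FractionalIdeal.mul_le]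
    intro i hi u hu
    rw [FractionalIdeal.mem_inv_iff hne'] at hu
    obtain ⟨i, hi', rfl⟩ := (FractionalIdeal.mem_coeIdeal _).1 hi
    obtain ⟨p, q, rfl⟩ := Ideal.mem_span_pair.1 hi'
    obtain ⟨ua, hua⟩ := (FractionalIdeal.mem_one_iff _).1 (hu (algebraMap R K a)
      (FractionalIdeal.mem_coeIdeal_of_mem _ (Ideal.subset_span (by simp))))
    obtain ⟨ub, hub⟩ := (FractionalIdeal.mem_one_iff _).1 (hu (algebraMap R K b)
      (FractionalIdeal.mem_coeIdeal_of_mem _ (Ideal.subset_span (by simp))))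
    have hrel : ua * b = ub * a := hinj (by rw [map_mul, map_mul, hua, hub]; ring)
    have hA : ua ∈ M := by
      by_contra h
      exact (hcon ua h).2 ub hrel
    have hB : ub ∈ M := by
      by_contra h
      exact (hcon ub h).1 ua hrel.symm
    refine (FractionalIdeal.mem_coeIdeal _).2 ⟨p * ua + q * ub,
      M.add_mem (M.mul_mem_left _ hA) (M.mul_mem_left _ hB), ?_⟩
    simp only [map_add, map_mul, hua, hub]
    ring
  have h2 := tOp_mono K hle
  rw [h1, hM.2.1] at h2
  have h3 : (1 : K) ∈ (M : FractionalIdeal R⁰ K) := h2 (Submodule.one_le.1 le_rfl)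
  obtain ⟨m, hm, hm1⟩ := (FractionalIdeal.mem_coeIdeal _).1 h3
  have : m = 1 := hinj (by simpa using hm1)
  exact hM.1 ((Ideal.eq_top_iff_one _).2 (this ▸ hm))

lemma mem_contrLoc (P : Ideal R) (hP : P.IsPrime) (x a : R) :
    a ∈ contrLoc K P x ↔ ∃ s, s ∉ P ∧ ∃ r, s * a = r * x := by
  have hinj := IsFractionRing.injective R K
  rw [contrLoc, Submodule.mem_comap, mem_locMul' K P hP]
  refine exists_congr fun s => and_congr_right fun _ => ?_
  rw [Submodule.mem_map]
  constructor
  · rintro ⟨y, hy, h⟩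
    obtain ⟨c, rfl⟩ := Ideal.mem_span_singleton'.1 hy
    exact ⟨c, (hinj (by simpa using h)).symm⟩
  · rintro ⟨r, h⟩
    exact ⟨r * x, Ideal.mem_span_singleton'.2 ⟨r, rfl⟩, by rw [← h]; simp⟩

lemma common_denom (P : Ideal R) (hP : P.IsPrime) (x : R) (L : Ideal R) (hL : L.FG) :
    L ≤ contrLoc K P x → ∃ s, s ∉ P ∧ ∀ j ∈ L, ∃ r, s * j = r * x := by
  induction L, hL using Submodule.fg_induction with
  | singleton z =>
    intro h
    obtain ⟨s, hs, r, hr⟩ := (mem_contrLoc K P hP x z).1 (h (Submodule.mem_span_singleton_self z))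
    refine ⟨s, hs, fun j hj => ?_⟩
    obtain ⟨c, rfl⟩ := Ideal.mem_span_singleton'.1 hj
    exact ⟨c * r, by linear_combination c * hr⟩
  | sup A B _ _ hA hB =>
    intro h
    obtain ⟨s, hs, h1⟩ := hA (le_sup_left.trans h)
    obtain ⟨t, ht, h2⟩ := hB (le_sup_right.trans h)
    refine ⟨s * t, fun h => (hP.mem_or_mem h).elim hs ht, fun j hj => ?_⟩
    obtain ⟨a, ha, b, hb, rfl⟩ := Submodule.mem_sup.1 hj
    obtain ⟨r, hr⟩ := h1 a ha
    obtain ⟨q, hq⟩ := h2 b hb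
    exact ⟨t * r + s * q, by linear_combination t * hr + s * hq⟩

lemma le_radical (x : R) (P : Ideal R) (hP : P ∈ (Ideal.span {x} : Ideal R).minimalPrimes) :
    P ≤ (contrLoc K P x).radical := by
  have hPp : P.IsPrime := hP.1.1
  intro p hp
  by_contra hcon
  let S : Submonoid R := P.primeCompl ⊔ Submonoid.powers p
  have hd : Disjoint ((Ideal.span {x} : Ideal R) : Set R) S := by
    rw [Set.disjoint_left]
    intro z hz hzS
    obtain ⟨s, hs, q, ⟨n, rfl⟩, rfl⟩ := Submonoid.mem_sup.1 hzS
    apply hcon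
    obtain ⟨c, hc⟩ := Ideal.mem_span_singleton'.1 hz
    exact ⟨n, (mem_contrLoc K P hPp x _).2 ⟨s, hs, c, hc.symm⟩⟩
  obtain ⟨Q, hQ, hxQ, hdQ⟩ := Ideal.exists_le_prime_disjoint _ S hd
  rw [Set.disjoint_left] at hdQ
  have hQP : Q ≤ P := by
    intro q hq
    by_contra h
    exact hdQ hq (Submonoid.mem_sup_left (show q ∈ P.primeCompl from h))
  exact hdQ (hP.2 ⟨hQ, hxQ⟩ hQP hp) (Submonoid.mem_sup_right (Submonoid.mem_powers p))

lemma gv_not_le (x : R) (hx0 : x ≠ 0) (P : Ideal R)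
    (hP : P ∈ (Ideal.span {x} : Ideal R).minimalPrimes) (J : Ideal R) (hfg : J.FG)
    (hgv : IsGV K J) : ¬ J ≤ P := by
  have hinj := IsFractionRing.injective R K
  have hPp : P.IsPrime := hP.1.1
  intro hle
  obtain ⟨n, hn⟩ := Ideal.exists_pow_le_of_le_radical_of_fg (hle.trans (le_radical K x P hP)) hfg
  obtain ⟨s, hs, h⟩ := common_denom K P hPp x _ (Ideal.FG.pow hfg) hn
  have hx : algebraMap R K x ≠ 0 := by
    intro h; exact hx0 (hinj (by simpa using h))
  obtain ⟨c, hc⟩ := hgv.pow n (algebraMap R K s / algebraMap R K x) fun j hj => by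
    obtain ⟨r, hr⟩ := h j hj
    refine ⟨r, ?_⟩
    rw [div_mul_eq_mul_div, eq_div_iff hx, ← map_mul, ← map_mul, hr]
  rw [eq_div_iff hx, ← map_mul] at hc
  have := hinj hc
  exact hs (this ▸ P.mul_mem_left c (hP.1.2 (Ideal.mem_span_singleton_self x)))

lemma wOp_le (hnf : ¬ IsField R) (A B : Ideal R)
    (h : ∀ M, IsMaxTIdeal K M → ∀ a ∈ A, ∃ t, t ∉ M ∧ t * a ∈ B) :
    wOp K (A : FractionalIdeal R⁰ K) ≤ wOp K (B : FractionalIdeal R⁰ K) := by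
  refine iInf_mono fun M => iInf_mono fun hM => ?_
  have hp := max_prime K (maximal_of_max_t K hnf hM)
  intro y hy
  rw [mem_locMul' K M hp] at hy ⊢
  obtain ⟨t, ht, hy⟩ := hy
  obtain ⟨a, ha, hay⟩ := (FractionalIdeal.mem_coeIdeal _).1 hy
  obtain ⟨s, hs, hsa⟩ := h M hM a ha
  refine ⟨s * t, fun h => (hp.mem_or_mem h).elim hs ht, ?_⟩
  refine (FractionalIdeal.mem_coeIdeal _).2 ⟨_, hsa, ?_⟩
  rw [map_mul, map_mul, hay, mul_assoc]

lemma aux_le (I : Ideal R) (x : R) (hx : x ∈ I) :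
    (Ideal.span {x} + I ^ 2) * I ^ 1 ≤ I ^ (1 + 1) := by
  rw [pow_succ I 1, pow_one]
  have h1 : Ideal.span {x} ≤ I := (Ideal.span_singleton_le_iff_mem _).2 hx
  have h2 : I * I ≤ I := Ideal.mul_le.2 fun r hr s _ => I.mul_mem_right s hr
  have h3 : Ideal.span {x} + I * I ≤ I := sup_le h1 h2
  exact Ideal.mul_mono h3 le_rfl

lemma aux_mem1 (I : Ideal R) (x c : R) (hc : c ∈ I) :
    x * c ∈ (Ideal.span {x} + I ^ 2) * I ^ 1 := by
  rw [pow_one]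
  exact Ideal.mul_mem_mul (Ideal.mem_sup_left (Ideal.mem_span_singleton_self x)) hc

lemma aux_mem2 (I : Ideal R) (x c a : R) (hc : c ∈ I) (ha : a ∈ I ^ (1 + 1)) :
    c * a ∈ (Ideal.span {x} + I ^ 2) * I ^ 1 := by
  rw [pow_one, mul_comm c a]
  exact Ideal.mul_mem_mul (Ideal.mem_sup_right ha) hc

end helpers

/-- Let `R` be a PvMD (not a field), `x` a nonzero nonunit of `R`, `P` a prime minimal over
`xR`, and `I = xR_P ∩ R`.  Then (1) `I` is a `w`-ideal, and (2) `xR + I²` is a `w`-reduction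
of `I`. -/
theorem w_ideal_and_w_reduction_of_contraction
    {R K : Type*} [CommRing R] [IsDomain R] [Field K] [Algebra R K] [IsFractionRing R K]
    (hnf : ¬ IsField R) (hpvmd : IsPvMD (R := R) K)
    (x : R) (hx0 : x ≠ 0) (hxu : ¬ IsUnit x)
    (P : Ideal R) (hP : P ∈ (Ideal.span {x} : Ideal R).minimalPrimes) :
    wOp K ((contrLoc K P x : Ideal R) : FractionalIdeal R⁰ K)
        = (((contrLoc K P x : Ideal R) : FractionalIdeal R⁰ K) : Submodule R K)
      ∧ ∃ n : ℕ,
        wOp K ((((Ideal.span {x} + contrLoc K P x ^ 2) * contrLoc K P x ^ n : Ideal R) :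
            FractionalIdeal R⁰ K))
          = wOp K (((contrLoc K P x ^ (n + 1) : Ideal R) : FractionalIdeal R⁰ K)) := by
  have hinj := IsFractionRing.injective R K
  have hPp : P.IsPrime := hP.1.1
  have hxP : x ∈ P := hP.1.2 (Ideal.mem_span_singleton_self x)
  have h1P : (1 : R) ∉ P := fun h => hPp.ne_top ((Ideal.eq_top_iff_one _).2 h)
  have hmem := mem_contrLoc K P hPp x
  have hxI : x ∈ contrLoc K P x := (hmem x).2 ⟨1, h1P, 1, rfl⟩
  constructor
  · apply le_antisymm
    · intro y hy
      let N : Ideal R := Submodule.comap (LinearMap.toSpanSingleton R K y)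
        (((contrLoc K P x : Ideal R) : FractionalIdeal R⁰ K) : Submodule R K)
      have hN : ∀ t, t ∈ N ↔ ∃ a ∈ contrLoc K P x, algebraMap R K a = algebraMap R K t * y := by
        intro t
        rw [← Algebra.smul_def]
        exact FractionalIdeal.mem_coeIdeal R⁰
      obtain ⟨J, hfg, hJN, hgv⟩ := exists_gv K hnf N (by
        intro M hM hle
        have hy' := (Submodule.mem_iInf _).1 ((Submodule.mem_iInf _).1 hy M) hM
        rw [mem_locMul' K M (max_prime K (maximal_of_max_t K hnf hM))] at hy'
        obtain ⟨t, ht, hty⟩ := hy'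
        exact ht (hle ((hN t).2 ((FractionalIdeal.mem_coeIdeal _).1 hty))))
      obtain ⟨r, rfl⟩ := hgv y fun j hj => by
        obtain ⟨a, _, ha⟩ := (hN j).1 (hJN hj)
        exact ⟨a, by rw [ha, mul_comm]⟩
      obtain ⟨s, hsJ, hsP⟩ := SetLike.not_le_iff_exists.1 (gv_not_le K x hx0 P hP J hfg hgv)
      obtain ⟨a, haI, ha⟩ := (hN s).1 (hJN hsJ)
      rw [← map_mul] at ha
      have ha' := hinj ha
      subst ha'
      obtain ⟨s', hs', c, hc⟩ := (hmem _).1 haI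
      refine (FractionalIdeal.mem_coeIdeal _).2 ⟨r, (hmem r).2 ⟨s' * s,
        fun h => (hPp.mem_or_mem h).elim hs' hsP, c, ?_⟩, rfl⟩
      rw [mul_assoc, hc]
    · intro y hy
      refine (Submodule.mem_iInf _).2 fun M => (Submodule.mem_iInf _).2 fun hM => ?_
      rw [mem_locMul' K M (max_prime K (maximal_of_max_t K hnf hM))]
      exact ⟨1, fun h => hM.1 ((Ideal.eq_top_iff_one _).2 h), by simpa using hy⟩
  · refine ⟨1, le_antisymm ?_ ?_⟩
    · refine wOp_le K hnf _ _ fun M hM a ha =>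
        ⟨1, fun h => hM.1 ((Ideal.eq_top_iff_one _).2 h), ?_⟩
      rw [one_mul]
      exact aux_le _ _ hxI ha
    · refine wOp_le K hnf _ _ fun M hM a ha => ?_
      have hMp := max_prime K (maximal_of_max_t K hnf hM)
      by_cases hPM : P ≤ M
      · rw [pow_succ, pow_one] at ha
        refine Submodule.mul_induction_on ha ?_ ?_
        · intro a ha b hb
          obtain ⟨s, hs, r, hr⟩ := (hmem a).1 ha
          obtain ⟨s', hs', r', hr'⟩ := (hmem b).1 hb
          have hss : s * s' ∉ P := fun h => (hPp.mem_or_mem h).elim hs hs'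
          have hss0 : s * s' ≠ 0 := fun h => hss (h ▸ P.zero_mem)
          obtain ⟨t, ht, ⟨c, hc⟩ | ⟨d, hd⟩⟩ := val_of_pvmd K hpvmd hM x (s * s') hx0
          · refine ⟨t, ht, ?_⟩
            have hcI : c * r * r' ∈ contrLoc K P x :=
              (hmem _).2 ⟨s * s', hss, t * r * r', by linear_combination (-r * r') * hc⟩
            have : t * (a * b) = x * (c * r * r') := by
              apply mul_left_cancel₀ hss0
              linear_combination (t * s' * b) * hr + (t * r * x) * hr' + (x * r * r') * hc
            rw [this]
            exact aux_mem1 _ _ _ hcI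
          · exfalso
            have : t * (s * s') ∈ P := hd ▸ P.mul_mem_left d hxP
            exact (hPp.mem_or_mem this).elim (fun h => ht (hPM h)) hss
        · rintro a b ⟨t, ht, hta⟩ ⟨s, hs, hsb⟩
          refine ⟨t * s, fun h => (hMp.mem_or_mem h).elim ht hs, ?_⟩
          have := Ideal.add_mem _ (Ideal.mul_mem_left _ s hta) (Ideal.mul_mem_left _ t hsb)
          convert this using 1
          ring
      · obtain ⟨p, hpP, hpM⟩ := SetLike.not_le_iff_exists.1 hPM
        obtain ⟨n, hn⟩ := le_radical K x P hP hpP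
        refine ⟨p ^ n, fun h => hpM (hMp.mem_of_pow_mem n h), ?_⟩
        exact aux_mem2 _ _ _ _ hn ha
end
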